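/- Let f : ℝ^n × ℝ^m → ℝ^n satisfy ‖f(x,u) − f(x*,u)‖ ≤ L_x‖x − x*‖ for all x, x* ∈ ℝ^n, u ∈ ℝ^m, with L_x > 0. Let V : ℝ^n → ℝ be differentiable with ‖∇V(z)‖ ≤ G for all z ∈ ℝ^n, let ν ≥ 0, β ≥ 0, Δ > 0, and let ρ > ρ_e > 0 satisfy ρ_e ≤ ρ − G·β e^{L_x Δ} − ν·(β e^{L_x Δ})². Let u : [t_k, t_k+Δ] → ℝ^m, and let x, x̃ : [t_k, t_k+Δ] → ℝ^n be differentiable with x′(t) = f(x(t), u(t)) and x̃′(t) = f(x̃(t), u(t)) for all t, with ‖x(t_k) − x̃(t_k)‖ ≤ β. If V(x̃(t)) ≤ ρ_e for all t ∈ [t_k, t_k+Δ], then V(x(t)) ≤ ρ for all t ∈ [t_k, t_k+Δ]. -/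

import Mathlib

/-- A differentiable function whose gradient is bounded by `G` grows at most
linearly with slope `G`. -/
theorem le_add_mul_norm_sub_of_norm_gradient_le {E : Type*} [NormedAddCommGroup E]
    [InnerProductSpace ℝ E] [CompleteSpace E] {V : E → ℝ} (hV : Differentiable ℝ V) {G : ℝ}
    (hG : ∀ z, ‖gradient V z‖ ≤ G) (a b : E) : V a ≤ V b + G * ‖a - b‖ := by
  have hbound : ∀ z ∈ (Set.univ : Set E), ‖fderiv ℝ V z‖ ≤ G := fun z _ => by
    simpa [gradient] using hG z
  have h := convex_univ.norm_image_sub_le_of_norm_fderiv_le (fun z _ => hV z) hbound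
    (Set.mem_univ b) (Set.mem_univ a)
  linarith [(Real.le_norm_self _).trans h]

/-- Two trajectories of the same Lipschitz controlled system, driven by the same input on
`[a, b]`, diverge at most exponentially. -/
theorem norm_sub_le_mul_exp_of_hasDerivAt {E U : Type*} [NormedAddCommGroup E] [NormedSpace ℝ E]
    {f : E → U → E} {L : ℝ} (hL : 0 ≤ L) (hf : ∀ x y u, ‖f x u - f y u‖ ≤ L * ‖x - y‖)
    {a b δ : ℝ} {u : ℝ → U} {x y : ℝ → E}
    (hx : ∀ t ∈ Set.Icc a b, HasDerivAt x (f (x t) (u t)) t)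
    (hy : ∀ t ∈ Set.Icc a b, HasDerivAt y (f (y t) (u t)) t)
    (hδ : ‖x a - y a‖ ≤ δ) {t : ℝ} (ht : t ∈ Set.Icc a b) :
    ‖x t - y t‖ ≤ δ * Real.exp (L * (t - a)) := by
  lift L to NNReal using hL
  have hlip : ∀ t, LipschitzWith L fun z => f z (u t) := fun t =>
    LipschitzWith.of_dist_le_mul fun z w => by
      simpa only [dist_eq_norm] using hf z w (u t)
  rw [← dist_eq_norm] at hδ ⊢
  exact dist_le_of_trajectories_ODE hlip
    (fun t ht => (hx t ht).continuousAt.continuousWithinAt)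
    (fun t ht => (hx t (Set.Ico_subset_Icc_self ht)).hasDerivWithinAt)
    (fun t ht => (hy t ht).continuousAt.continuousWithinAt)
    (fun t ht => (hy t (Set.Ico_subset_Icc_self ht)).hasDerivWithinAt) hδ t ht

/-- Trajectory form of Theorem 1 (Mode 1 of the LEMPC): if the predicted
trajectory `xt` stays in the inner region `Ω_{ρe}` over one sampling period of
length `Δ`, and the true trajectory `x` follows the same dynamics under the
same input with initial estimation error at most `β`, then the true state
remains in the stability region `Ω_ρ` throughout the sampling period, provided
`ρe` satisfies the shrinkage condition of Theorem 1. -/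
theorem stmt_8 {n m : ℕ}
    (f : EuclideanSpace ℝ (Fin n) → EuclideanSpace ℝ (Fin m) → EuclideanSpace ℝ (Fin n))
    (Lx : ℝ) (hLx : 0 < Lx)
    (hf : ∀ x x' u, ‖f x u - f x' u‖ ≤ Lx * ‖x - x'‖)
    (V : EuclideanSpace ℝ (Fin n) → ℝ) (hV : Differentiable ℝ V)
    (G : ℝ) (hgrad : ∀ z, ‖gradient V z‖ ≤ G)
    (ν β Δ ρ ρe : ℝ) (hν : 0 ≤ ν) (hβ : 0 ≤ β) (hΔ : 0 < Δ)
    (hρρe : ρe < ρ) (hρe : 0 < ρe)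
    (hshrink : ρe ≤ ρ - G * (β * Real.exp (Lx * Δ)) - ν * (β * Real.exp (Lx * Δ)) ^ 2)
    (tk : ℝ) (u : ℝ → EuclideanSpace ℝ (Fin m))
    (x xt : ℝ → EuclideanSpace ℝ (Fin n))
    (hx : ∀ t ∈ Set.Icc tk (tk + Δ), HasDerivAt x (f (x t) (u t)) t)
    (hxt : ∀ t ∈ Set.Icc tk (tk + Δ), HasDerivAt xt (f (xt t) (u t)) t)
    (hinit : ‖x tk - xt tk‖ ≤ β)
    (hmode : ∀ t ∈ Set.Icc tk (tk + Δ), V (xt t) ≤ ρe) :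
    ∀ t ∈ Set.Icc tk (tk + Δ), V (x t) ≤ ρ := by
  intro t ht
  have herr : ‖x t - xt t‖ ≤ β * Real.exp (Lx * Δ) :=
    (norm_sub_le_mul_exp_of_hasDerivAt hLx.le hf hx hxt hinit ht).trans <| by
      gcongr
      linarith [ht.2]
  have hG : 0 ≤ G := (norm_nonneg _).trans (hgrad 0)
  have hlip := le_add_mul_norm_sub_of_norm_gradient_le hV hgrad (x t) (xt t)
  have hmul := mul_le_mul_of_nonneg_left herr hG
  have hsq := mul_nonneg hν (sq_nonneg (β * Real.exp (Lx * Δ)))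
  linarith [hmode t ht]
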